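/- For every α with −1 < α ≤ 1, the Lie algebra g_α does not contract onto g_{−1}: there is no family Φ_t of linear automorphisms of ℝ^8, t ∈ [1,∞), such that the limit lim_{t→∞} Φ_t^{-1}(μ_α(Φ_t X, Φ_t Y)) exists for all X,Y and defines a Lie bracket whose Lie algebra is isomorphic to g_{−1}. -/

import Mathlib

/-- The underlying space `ℝ⁸` of the family `g_α`. -/
abbrev V8 : Type := Fin 8 → ℝ

/-- The standard basis vector `X_{k+1}` (0-indexed: `e8 k`). -/
def e8 (k : Fin 8) : V8 := fun l => if l = k then 1 else 0

/-- Brackets of basis elements of `g_α` for `i < j` (0-indexed, `X_{i+1} = e8 i`):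
`u α i j = [X_{i+1}, X_{j+1}]`. -/
noncomputable def gUpper (α : ℝ) : Fin 8 → Fin 8 → V8 := fun i j =>
  match (i : ℕ), (j : ℕ) with
  | 0, 1 => (2 : ℝ) • e8 1          -- [X₁,X₂] = 2X₂
  | 0, 2 => (-2 : ℝ) • e8 2         -- [X₁,X₃] = −2X₃
  | 1, 2 => e8 0                    -- [X₂,X₃] = X₁
  | 0, 3 => e8 3                    -- [X₁,X₄] = X₄
  | 0, 4 => -e8 4                   -- [X₁,X₅] = −X₅
  | 0, 5 => e8 5                    -- [X₁,X₆] = X₆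
  | 0, 6 => -e8 6                   -- [X₁,X₇] = −X₇
  | 1, 4 => e8 3                    -- [X₂,X₅] = X₄
  | 1, 6 => e8 5                    -- [X₂,X₇] = X₆
  | 2, 3 => e8 4                    -- [X₃,X₄] = X₅
  | 2, 5 => e8 6                    -- [X₃,X₆] = X₇
  | 3, 7 => e8 3                    -- [X₄,X₈] = X₄
  | 4, 7 => e8 4                    -- [X₅,X₈] = X₅
  | 5, 7 => α • e8 5                -- [X₆,X₈] = αX₆
  | 6, 7 => α • e8 6                -- [X₇,X₈] = αX₇
  | _, _ => 0

/-- The structure constants `C_{ij}^k` of `g_α`. -/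
noncomputable def gC (α : ℝ) (i j k : Fin 8) : ℝ := gUpper α i j k - gUpper α j i k

/-- The bilinear map on `ℝ⁸` with structure constants `C`. -/
noncomputable def brOf (C : Fin 8 → Fin 8 → Fin 8 → ℝ) : V8 →ₗ[ℝ] V8 →ₗ[ℝ] V8 :=
  LinearMap.mk₂ ℝ (fun x y k => ∑ i, ∑ j, C i j k * x i * y j)
    (by
      intro x x' y
      funext k
      simp only [Pi.add_apply]
      rw [← Finset.sum_add_distrib]
      refine Finset.sum_congr rfl fun i _ => ?_
      rw [← Finset.sum_add_distrib]
      exact Finset.sum_congr rfl fun j _ => by ring)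
    (by
      intro c x y
      funext k
      simp only [Pi.smul_apply, smul_eq_mul]
      rw [Finset.mul_sum]
      refine Finset.sum_congr rfl fun i _ => ?_
      rw [Finset.mul_sum]
      exact Finset.sum_congr rfl fun j _ => by ring)
    (by
      intro x y y'
      funext k
      simp only [Pi.add_apply]
      rw [← Finset.sum_add_distrib]
      refine Finset.sum_congr rfl fun i _ => ?_
      rw [← Finset.sum_add_distrib]
      exact Finset.sum_congr rfl fun j _ => by ring)
    (by
      intro c x y
      funext k
      simp only [Pi.smul_apply, smul_eq_mul]
      rw [Finset.mul_sum]
      refine Finset.sum_congr rfl fun i _ => ?_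
      rw [Finset.mul_sum]
      exact Finset.sum_congr rfl fun j _ => by ring)

/-- The Lie bracket `μ_α` of the Lie algebra `g_α`, as a bilinear map on `ℝ⁸`. -/
noncomputable def brA (α : ℝ) : V8 →ₗ[ℝ] V8 →ₗ[ℝ] V8 := brOf (gC α)

lemma sum_smul_gUpper (α : ℝ) (x y : V8) :
    ∑ i, ∑ j, (x i * y j) • gUpper α i j =
      ![x 1 * y 2,
        2 * x 0 * y 1,
        -2 * x 0 * y 2,
        x 0 * y 3 + x 1 * y 4 + x 3 * y 7,
        -x 0 * y 4 + x 2 * y 3 + x 4 * y 7,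
        x 0 * y 5 + x 1 * y 6 + α * x 5 * y 7,
        -x 0 * y 6 + x 2 * y 5 + α * x 6 * y 7,
        0] := by
  simp only [Fin.sum_univ_eight, gUpper, Fin.isValue, Fin.coe_ofNat_eq_mod, Nat.reduceMod,
    smul_zero, add_zero, zero_add]
  ext k
  fin_cases k <;> simp [e8] <;> ring

lemma brA_apply (α : ℝ) (x y : V8) :
    brA α x y = ∑ i, ∑ j, (x i * y j) • gUpper α i j - ∑ i, ∑ j, (y i * x j) • gUpper α i j := by
  ext k
  rw [Finset.sum_comm (f := fun i j => (y i * x j) • gUpper α i j)]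
  simp only [brA, brOf, gC, LinearMap.mk₂_apply, Pi.sub_apply, Finset.sum_apply, Pi.smul_apply,
    smul_eq_mul, ← Finset.sum_sub_distrib]
  exact Finset.sum_congr rfl fun i _ => Finset.sum_congr rfl fun j _ => by ring

/-- The matrix of `ad x` in the Lie algebra `g_α`. -/
lemma toMatrix'_brA (α : ℝ) (x : V8) :
    LinearMap.toMatrix' (brA α x) =
      !![0, -x 2, x 1, 0, 0, 0, 0, 0;
         -2 * x 1, 2 * x 0, 0, 0, 0, 0, 0, 0;
         2 * x 2, 0, -2 * x 0, 0, 0, 0, 0, 0;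
         -x 3, -x 4, 0, x 0 - x 7, x 1, 0, 0, x 3;
         x 4, 0, -x 3, x 2, -x 0 - x 7, 0, 0, x 4;
         -x 5, -x 6, 0, 0, 0, x 0 - α * x 7, x 1, α * x 5;
         x 6, 0, -x 5, 0, 0, x 2, -x 0 - α * x 7, α * x 6;
         0, 0, 0, 0, 0, 0, 0, 0] := by
  ext k j
  rw [LinearMap.toMatrix'_apply, brA_apply, sum_smul_gUpper, sum_smul_gUpper]
  fin_cases k <;> fin_cases j <;> simp

lemma trace_brA (α : ℝ) (x : V8) :
    (LinearMap.toMatrix' (brA α x)).trace = -2 * (1 + α) * x 7 := by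
  rw [toMatrix'_brA]
  simp [Matrix.trace, Fin.sum_univ_eight]
  ring

/-- The Killing form of `g_α`. -/
lemma trace_brA_mul_brA (α : ℝ) (x y : V8) :
    (LinearMap.toMatrix' (brA α x) * LinearMap.toMatrix' (brA α y)).trace =
      12 * x 0 * y 0 + 6 * (x 1 * y 2 + x 2 * y 1) + 2 * (1 + α ^ 2) * x 7 * y 7 := by
  rw [toMatrix'_brA, toMatrix'_brA]
  simp [Matrix.trace, Fin.sum_univ_eight]
  ring

/-- The invariant symmetric form `tr (A B) - c tr A tr B` on square matrices. -/
noncomputable def traceForm (c : ℝ) (A B : Matrix (Fin 8) (Fin 8) ℝ) : ℝ :=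
  (A * B).trace - c * (A.trace * B.trace)

open Filter Topology in
lemma Filter.Tendsto.traceForm {ι : Type*} {l : Filter ι} (c : ℝ)
    {f g : ι → Matrix (Fin 8) (Fin 8) ℝ} {A B : Matrix (Fin 8) (Fin 8) ℝ}
    (hf : Tendsto f l (𝓝 A)) (hg : Tendsto g l (𝓝 B)) :
    Tendsto (fun t => traceForm c (f t) (g t)) l (𝓝 (traceForm c A B)) := by
  have h : Continuous fun p : Matrix (Fin 8) (Fin 8) ℝ × Matrix (Fin 8) (Fin 8) ℝ =>
      _root_.traceForm c p.1 p.2 := by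
    unfold _root_.traceForm
    fun_prop
  have hlim := (h.tendsto (A, B)).comp (hf.prodMk_nhds hg)
  simpa only [Function.comp_def] using hlim

lemma traceForm_conj (c : ℝ) (Ψ : V8 ≃ₗ[ℝ] V8) (f g : V8 →ₗ[ℝ] V8) :
    traceForm c (LinearMap.toMatrix' (Ψ.symm.conj f)) (LinearMap.toMatrix' (Ψ.symm.conj g)) =
      traceForm c (LinearMap.toMatrix' f) (LinearMap.toMatrix' g) := by
  have key : ∀ h : V8 →ₗ[ℝ] V8,
      (LinearMap.toMatrix' (Ψ.symm.conj h)).trace = (LinearMap.toMatrix' h).trace := fun h => by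
    rw [← LinearMap.toMatrix_eq_toMatrix', ← LinearMap.trace_eq_matrix_trace,
      ← LinearMap.trace_eq_matrix_trace, LinearMap.trace_conj']
  unfold traceForm
  rw [key, key, ← LinearMap.toMatrix'_mul, ← LinearMap.toMatrix'_mul, Module.End.mul_eq_comp,
    ← LinearEquiv.conj_comp, key]
  rfl

/-- For `α ≠ -1` a suitable combination of the Killing form of `g_α` and the square of the
trace of `ad` has rank at most three, so its Gram determinants of order four vanish. -/
lemma det_traceForm_brA_eq_zero {α : ℝ} (hα : 1 + α ≠ 0) (v : Fin 4 → V8) :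
    (Matrix.of fun i j => traceForm ((1 + α ^ 2) / (2 * (1 + α) ^ 2))
      (LinearMap.toMatrix' (brA α (v i))) (LinearMap.toMatrix' (brA α (v j)))).det = 0 := by
  have h : (Matrix.of fun i j => traceForm ((1 + α ^ 2) / (2 * (1 + α) ^ 2))
      (LinearMap.toMatrix' (brA α (v i))) (LinearMap.toMatrix' (brA α (v j)))) =
      (Matrix.of fun i => ![12 * v i 0, 6 * v i 1, 6 * v i 2, 0]) *
        Matrix.of ![fun j => v j 0, fun j => v j 2, fun j => v j 1, fun _ => 0] := by
    ext i j
    simp only [traceForm, trace_brA, trace_brA_mul_brA, Matrix.mul_apply, Fin.sum_univ_four,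
      Matrix.of_apply]
    simp
    field_simp
    ring
  rw [h, Matrix.det_mul, Matrix.det_eq_zero_of_column_eq_zero 3 (fun i => by simp), zero_mul]

/-- The Killing form of `g_{-1}` is nondegenerate on the span of `X₁, X₂, X₃, X₈`, and the
trace of `ad` vanishes. -/
lemma det_traceForm_brA_neg_one_ne_zero (c : ℝ) :
    (Matrix.of fun i j : Fin 4 => traceForm c
      (LinearMap.toMatrix' (brA (-1) (![e8 0, e8 1, e8 2, e8 7] i)))
      (LinearMap.toMatrix' (brA (-1) (![e8 0, e8 1, e8 2, e8 7] j)))).det ≠ 0 := by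
  have h : (Matrix.of fun i j : Fin 4 => traceForm c
      (LinearMap.toMatrix' (brA (-1) (![e8 0, e8 1, e8 2, e8 7] i)))
      (LinearMap.toMatrix' (brA (-1) (![e8 0, e8 1, e8 2, e8 7] j)))) =
      !![12, 0, 0, 0; 0, 0, 6, 0; 0, 6, 0, 0; 0, 0, 0, 4] := by
    ext i j
    simp only [traceForm, trace_brA, trace_brA_mul_brA, Matrix.of_apply]
    fin_cases i <;> fin_cases j <;> simp [e8] <;> norm_num
  rw [h]
  simp [Matrix.det_succ_row_zero, Fin.sum_univ_succ, Fin.succAbove]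

open Filter Topology in
/-- For `−1 < α ≤ 1`, the Lie algebra `g_α` does not contract onto `g_{−1}`: there is no
family `Φ_t` of linear automorphisms of `ℝ⁸` such that the limits
`lim_{t→∞} Φ_t⁻¹ (μ_α (Φ_t X) (Φ_t Y))` all exist and define a bracket whose Lie algebra
is isomorphic to `g_{−1}`. -/
theorem no_contraction_onto_g_minus_one (α : ℝ) (h1 : -1 < α) (h2 : α ≤ 1) :
    ¬ ∃ (Φ : ℝ → (V8 ≃ₗ[ℝ] V8)) (ν : V8 → V8 → V8),
        (∀ X Y : V8,
          Tendsto (fun t : ℝ => (Φ t).symm (brA α (Φ t X) (Φ t Y))) atTop (𝓝 (ν X Y))) ∧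
        (∃ e : V8 ≃ₗ[ℝ] V8, ∀ x y : V8, e (ν x y) = brA (-1) (e x) (e y)) := by
  rintro ⟨Φ, ν, hν, e, he⟩
  set c : ℝ := (1 + α ^ 2) / (2 * (1 + α) ^ 2)
  set w : Fin 4 → V8 := ![e8 0, e8 1, e8 2, e8 7]
  let Ψ : ℝ → (V8 ≃ₗ[ℝ] V8) := fun t => e.symm.trans (Φ t)
  have hlim : ∀ x : V8, Tendsto
      (fun t => LinearMap.toMatrix' ((Ψ t).symm.conj (brA α (Ψ t x)))) atTop
      (𝓝 (LinearMap.toMatrix' (brA (-1) x))) := by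
    intro x
    refine tendsto_pi_nhds.2 fun k => tendsto_pi_nhds.2 fun j => ?_
    have he' : Continuous e := LinearMap.continuous_of_finiteDimensional e.toLinearMap
    have h := (he'.tendsto _).comp (hν (e.symm x) (e.symm (Pi.single j 1)))
    rw [he, e.apply_symm_apply, e.apply_symm_apply] at h
    simpa [LinearMap.toMatrix'_apply, LinearEquiv.conj_apply, Ψ, Function.comp_def,
      Pi.single_apply] using tendsto_pi_nhds.1 h k
  have hdet : Tendsto (fun t => (Matrix.of fun i j => traceForm c
      (LinearMap.toMatrix' ((Ψ t).symm.conj (brA α (Ψ t (w i)))))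
      (LinearMap.toMatrix' ((Ψ t).symm.conj (brA α (Ψ t (w j)))))).det) atTop
      (𝓝 (Matrix.of fun i j => traceForm c (LinearMap.toMatrix' (brA (-1) (w i)))
        (LinearMap.toMatrix' (brA (-1) (w j)))).det) := by
    refine ((continuous_id.matrix_det).tendsto _).comp
      (tendsto_pi_nhds.2 fun i => tendsto_pi_nhds.2 fun j => ?_)
    exact (hlim (w i)).traceForm c (hlim (w j))
  refine det_traceForm_brA_neg_one_ne_zero c (tendsto_nhds_unique hdet
    (tendsto_const_nhds.congr fun t => ?_))
  simp only [traceForm_conj]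
  exact (det_traceForm_brA_eq_zero (by linarith) fun i => Ψ t (w i)).symm
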